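/- Every antisymmetric bilinear map θ : W(n)_μ × W(n)_μ → ℂ satisfying the 2-cocycle identity θ(x, [y, z]) + θ(y, [z, x]) + θ(z, [x, y]) = 0 for all x, y, z is cohomologous to a scalar multiple of the Virasoro cocycle: there exist a ∈ ℂ and a ℂ-linear map f : W(n)_μ → ℂ such that θ(x, y) = a·C_μ(x, y) + f([x, y]) for all x, y ∈ W(n)_μ, where C_μ(e_α, e_β) = δ_{α,−β}·((μ·α)³ − μ·α)/12. In other words, the universal central extension of W(n)_μ is one-dimensional, i.e. H²(W(n)_μ; ℂ) is one-dimensional. -/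

import Mathlib

/-- The index lattice `ℤⁿ` (as functions `Fin n → ℤ`). -/
abbrev Zn (n : ℕ) := Fin n → ℤ

/-- Underlying vector space of the solenoidal Witt algebra `W(n)_μ`:
finitely supported functions `ℤⁿ → ℂ`, with basis `e_α = single α 1`. -/
abbrev Wn (n : ℕ) := Zn n →₀ ℂ

/-- `μ·α = μ₁α₁ + ⋯ + μₙαₙ`. -/
noncomputable def mdot {n : ℕ} (μ : Fin n → ℂ) (α : Zn n) : ℂ :=
  ∑ i, μ i * (α i : ℂ)

/-- `μ` is generic: `μ·α ≠ 0` for every nonzero `α ∈ ℤⁿ`. -/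
def Generic {n : ℕ} (μ : Fin n → ℂ) : Prop :=
  ∀ α : Zn n, α ≠ 0 → mdot μ α ≠ 0

/-- The basis vector `e_α` of `W(n)_μ`. -/
noncomputable def ew {n : ℕ} (α : Zn n) : Wn n := Finsupp.single α 1

@[simp] lemma mdot_zero {n : ℕ} (μ : Fin n → ℂ) : mdot μ 0 = 0 := by
  simp [mdot]

@[simp] lemma mdot_add {n : ℕ} (μ : Fin n → ℂ) (α β : Zn n) :
    mdot μ (α + β) = mdot μ α + mdot μ β := by
  simp [mdot, mul_add, Finset.sum_add_distrib]

@[simp] lemma mdot_neg {n : ℕ} (μ : Fin n → ℂ) (α : Zn n) : mdot μ (-α) = -mdot μ α := by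
  simp [mdot]

@[simp] lemma mdot_sub {n : ℕ} (μ : Fin n → ℂ) (α β : Zn n) :
    mdot μ (α - β) = mdot μ α - mdot μ β := by
  rw [sub_eq_add_neg, mdot_add, mdot_neg, sub_eq_add_neg]

/-- A solution of the degree-zero cocycle equation which vanishes at `α₀` and `2α₀`,
where `μ·α₀ ≠ 0`, vanishes identically. -/
lemma eq_zero_of_cocycle_relation {n : ℕ} {μ : Fin n → ℂ} {φ : Zn n → ℂ}
    (hφ : ∀ α β, (mdot μ β - mdot μ α) * φ (α + β) =
      (2 * mdot μ α + mdot μ β) * φ β - (mdot μ α + 2 * mdot μ β) * φ α)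
    {α₀ : Zn n} (h₀ : mdot μ α₀ ≠ 0) (h₁ : φ α₀ = 0) (h₂ : φ (α₀ + α₀) = 0) (β : Zn n) :
    φ β = 0 := by
  have e₁ := hφ α₀ β
  have e₂ := hφ α₀ (α₀ + β)
  have e₃ := hφ (α₀ + α₀) β
  rw [← add_assoc] at e₂
  simp only [mdot_add, h₁, h₂, mul_zero, sub_zero] at e₁ e₂ e₃
  have key : 12 * mdot μ α₀ ^ 3 * φ β = 0 := by
    linear_combination -mdot μ β * (mdot μ β - mdot μ α₀) * e₃ +
      (mdot μ β - 2 * mdot μ α₀) * (mdot μ β - mdot μ α₀) * e₂ +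
      (mdot μ β - 2 * mdot μ α₀) * (3 * mdot μ α₀ + mdot μ β) * e₁
  simpa [h₀] using key

/-- Every solution of the degree-zero cocycle equation is a combination of the cube of
`μ·α` and `μ·α` itself. -/
lemma exists_cubic_of_cocycle_relation {n : ℕ} {μ : Fin n → ℂ} {φ : Zn n → ℂ}
    (hφ : ∀ α β, (mdot μ β - mdot μ α) * φ (α + β) =
      (2 * mdot μ α + mdot μ β) * φ β - (mdot μ α + 2 * mdot μ β) * φ α)
    {α₀ : Zn n} (h₀ : mdot μ α₀ ≠ 0) :
    ∃ p q : ℂ, ∀ α, φ α = p * mdot μ α ^ 3 + q * mdot μ α := by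
  set p : ℂ := (φ (α₀ + α₀) - 2 * φ α₀) / (6 * mdot μ α₀ ^ 3) with hp
  set q : ℂ := (8 * φ α₀ - φ (α₀ + α₀)) / (6 * mdot μ α₀) with hq
  refine ⟨p, q, fun α => ?_⟩
  rw [← sub_eq_zero]
  refine eq_zero_of_cocycle_relation (μ := μ)
    (φ := fun α => φ α - (p * mdot μ α ^ 3 + q * mdot μ α)) ?_ h₀ ?_ ?_ α
  · intro α β
    simp only [mdot_add]
    linear_combination hφ α β
  · simp only [hp, hq]
    field_simp
    ring
  · simp only [mdot_add, hp, hq]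
    field_simp
    ring

/-- Every antisymmetric bilinear 2-cocycle `θ` on the solenoidal Witt algebra `W(n)_μ`
is cohomologous to a scalar multiple of the Virasoro cocycle `C_μ`:
`θ(x,y) = a·C_μ(x,y) + f([x,y])` for some `a ∈ ℂ` and some linear `f : W(n)_μ → ℂ`.
In other words `H²(W(n)_μ; ℂ)` is one-dimensional. -/
theorem stmt2 (n : ℕ) (hn : 1 ≤ n) (μ : Fin n → ℂ) (hμ : Generic μ)
    (B : Wn n →ₗ[ℂ] Wn n →ₗ[ℂ] Wn n)
    (hB : ∀ α β : Zn n, B (ew α) (ew β) = Finsupp.single (α + β) (mdot μ (β - α)))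
    (C : Wn n →ₗ[ℂ] Wn n →ₗ[ℂ] ℂ)
    (hC : ∀ α β : Zn n, C (ew α) (ew β) =
      if α = -β then ((mdot μ α) ^ 3 - mdot μ α) / 12 else 0)
    (θ : Wn n →ₗ[ℂ] Wn n →ₗ[ℂ] ℂ)
    (hθskew : ∀ x y : Wn n, θ x y = - θ y x)
    (hθcoc : ∀ x y z : Wn n, θ x (B y z) + θ y (B z x) + θ z (B x y) = 0) :
    ∃ (a : ℂ) (f : Wn n →ₗ[ℂ] ℂ), ∀ x y : Wn n, θ x y = a * C x y + f (B x y) := by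
  have cocycle : ∀ α β γ : Zn n,
      (mdot μ γ - mdot μ β) * θ (ew α) (ew (β + γ)) +
      (mdot μ α - mdot μ γ) * θ (ew β) (ew (γ + α)) +
      (mdot μ β - mdot μ α) * θ (ew γ) (ew (α + β)) = 0 := by
    have single_eq (δ : Zn n) (c : ℂ) : Finsupp.single δ c = c • ew δ := by simp [ew]
    intro α β γ
    simpa [hB, single_eq] using hθcoc (ew α) (ew β) (ew γ)
  obtain ⟨α₀, h₀⟩ : ∃ α₀ : Zn n, mdot μ α₀ ≠ 0 :=
    ⟨fun _ => 1, hμ _ fun h => one_ne_zero (congrFun h ⟨0, hn⟩)⟩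
  obtain ⟨p, q, hpq⟩ := exists_cubic_of_cocycle_relation (μ := μ)
    (φ := fun α => θ (ew α) (ew (-α))) (fun α β => by
      have h := cocycle α β (-(α + β))
      have hskew := hθskew (ew (-(α + β))) (ew (α + β))
      rw [show β + -(α + β) = -α by abel, show -(α + β) + α = -β by abel, hskew] at h
      simp only [mdot_neg, mdot_add] at h
      linear_combination -h) h₀
  let F : Zn n → ℂ := fun γ =>
    if γ = 0 then -(p + q) / 2 else θ (ew 0) (ew γ) / mdot μ γ
  let f : Wn n →ₗ[ℂ] ℂ := Finsupp.linearCombination ℂ F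
  have hbasis : ∀ α β : Zn n,
      θ (ew α) (ew β) = 12 * p * C (ew α) (ew β) + f (B (ew α) (ew β)) := by
    intro α β
    simp only [hB, hC, f, F, Finsupp.linearCombination_single, smul_eq_mul, mdot_sub]
    by_cases h : α + β = 0
    · obtain rfl : β = -α := (neg_eq_of_add_eq_zero_right h).symm
      have hα := hpq α
      simp only [hα, neg_neg, if_true, h, mdot_neg]
      ring
    · have hne : α ≠ -β := fun h' => h (by simp [h'])
      have hm := hμ _ h
      have hc := cocycle 0 α β
      have hskew := hθskew (ew β) (ew α)
      simp only [add_zero, zero_add, mdot_zero, hskew] at hc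
      simp only [hne, h, if_false]
      field_simp
      rw [mdot_add]
      linear_combination -hc
  refine ⟨12 * p, f, fun x y => ?_⟩
  have hmaps : θ = (12 * p) • C + B.compr₂ f := by
    ext α β
    simpa [ew] using hbasis α β
  simp [hmaps]
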